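/- There exist positive constants B_0 and A_0 = A_0(λ) such that for any B ≥ B_0 and any sequence A = A(n) with A_0 ≤ A and A = o(n^{2/3}), and for all sufficiently large n, on the event G_{i−1}(B) one has P(t_i − t_{i−1} ≥ T | F_{t_{i−1}}) ≥ c_0 / T^{1/2} for each L+1 ≤ i ≤ 2L, for some constant c_0 = c_0(B) > 0. -/

import Mathlib

/-!
Statement 5 (Proposition `mainlemma` for `G(n,p)`): there exist positive constants `B₀`
and `A₀ = A₀(λ)` such that for any `B ≥ B₀` and any sequence `A = A(n)` with `A₀ ≤ A`
and `A = o(n^{2/3})`, for all sufficiently large `n`, on the event `G_{i-1}(B)` one has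
`P(t_i - t_{i-1} ≥ T | F_{t_{i-1}}) ≥ c₀/T^{1/2}` for each `L+1 ≤ i ≤ 2L`, for some
constant `c₀ = c₀(B) > 0`.
-/

open MeasureTheory Filter Asymptotics ProbabilityTheory

noncomputable section

def bernoulliBool (p : ℝ) : Measure Bool :=
  (Real.toNNReal p) • Measure.dirac true + (Real.toNNReal (1 - p)) • Measure.dirac false

def erMeasure (n : ℕ) (p : ℝ) : Measure (Sym2 (Fin n) → Bool) :=
  Measure.pi fun _ => bernoulliBool p

def pER (n : ℕ) (lam : ℝ) : ℝ := (1 + lam * (n : ℝ) ^ (-(1 / 3 : ℝ))) / n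

/-- One step of the exploration process (Algorithm 1).  The state records the pair
(set of active vertices, set of explored vertices); unseen vertices are the rest. -/
def erStep {n : ℕ} (ω : Sym2 (Fin n) → Bool)
    (st : Finset (Fin n) × Finset (Fin n)) : Finset (Fin n) × Finset (Fin n) :=
  if hA : st.1.Nonempty then
    let u := st.1.min' hA
    let U := Finset.univ \ (st.1 ∪ st.2)
    ((st.1.erase u) ∪ U.filter fun v => ω s(u, v) = true, insert u st.2)
  else
    let U := Finset.univ \ (st.1 ∪ st.2)
    if hU : U.Nonempty then
      let u := U.min' hU
      ((U.erase u).filter fun v => ω s(u, v) = true, insert u st.2)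
    else st

/-- The state of the exploration process at time `t`; at time `0` the first vertex is
active and all other vertices are unseen. -/
def erState {n : ℕ} (ω : Sym2 (Fin n) → Bool) : ℕ → Finset (Fin n) × Finset (Fin n)
  | 0 => (Finset.univ.filter fun v : Fin n => (v : ℕ) = 0, ∅)
  | t + 1 => erStep ω (erState ω t)

/-- `Y t`, the number of active vertices at the end of step `t`. -/
def erY {n : ℕ} (ω : Sym2 (Fin n) → Bool) (t : ℕ) : ℕ := (erState ω t).1.card

/-- `η t`, the number of unseen vertices becoming active at step `t`. -/
def erEta {n : ℕ} (ω : Sym2 (Fin n) → Bool) (t : ℕ) : ℕ :=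
  ((erState ω t).1 \ (erState ω (t - 1)).1).card

/-- The hitting times `t_i`: `t_0 = 0` and `t_i = min {t > t_{i-1} : Y_t = 0}`. -/
def erHit {n : ℕ} (ω : Sym2 (Fin n) → Bool) : ℕ → ℕ
  | 0 => 0
  | i + 1 => sInf {t | erHit ω i < t ∧ erY ω t = 0}

/-- The filtration of the exploration process: `F t` is the σ-algebra generated by the
information revealed by the exploration up to time `t` (the history of states). -/
def erF (n : ℕ) (t : ℕ) : MeasurableSpace (Sym2 (Fin n) → Bool) :=
  MeasurableSpace.comap (fun ω => fun s : Fin (t + 1) => erState ω s) ⊤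

/-- The σ-algebra associated with the random time `τ` and the filtration `F`
(for a stopping time this is the usual stopped σ-algebra). -/
def sigmaAt {Ω : Type*} (F : ℕ → MeasurableSpace Ω) (τ : Ω → ℕ) : MeasurableSpace Ω :=
  MeasurableSpace.generateFrom {s | ∀ t, MeasurableSet[F t] (s ∩ {ω | τ ω ≤ t})}

/-- `T = ⌈n^{2/3}/A⌉`. -/
def Tof (n : ℕ) (a : ℝ) : ℕ := Nat.ceil ((n : ℝ) ^ ((2 : ℝ) / 3) / a)

/-- `L = ⌊n/(2T)⌋`. -/
def Lof (n : ℕ) (a : ℝ) : ℕ := n / (2 * Tof n a)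

section ProductMeasure

theorem measureReal_eq_sum_inter_fiber {Ω β : Type*} [MeasurableSpace Ω]
    [DiscreteMeasurableSpace Ω] (μ : Measure Ω) [IsFiniteMeasure μ] (f : Ω → β) (s : Finset β)
    {A : Set Ω} (hA : ∀ ω ∈ A, f ω ∈ s) :
    μ.real A = ∑ b ∈ s, μ.real (A ∩ f ⁻¹' {b}) := by
  rw [← measureReal_biUnion_finset]
  · congr 1
    ext ω
    simp only [Set.mem_iUnion, Set.mem_inter_iff, Set.mem_preimage, Set.mem_singleton_iff]
    exact ⟨fun h => ⟨f ω, hA ω h, h, rfl⟩, fun ⟨_, _, h, _⟩ => h⟩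
  · intro b _ c _ hbc
    refine Set.disjoint_left.2 fun ω hb hc => hbc ?_
    exact hb.2.symm.trans hc.2
  · exact fun _ _ => MeasurableSet.of_discrete

/-- Under a product of discrete probability measures, events determined by disjoint sets of
coordinates are independent. -/
theorem pi_real_inter_eq_mul {ι α : Type*} [Fintype ι] [Finite α] [MeasurableSpace α]
    [MeasurableSingletonClass α] (ν : Measure α) [IsProbabilityMeasure ν]
    {s t : Set ι} (hst : Disjoint s t) {A B : Set (ι → α)}
    (hA : DependsOn (· ∈ A) s) (hB : DependsOn (· ∈ B) t) :
    (Measure.pi fun _ : ι => ν).real (A ∩ B) =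
      (Measure.pi fun _ : ι => ν).real A * (Measure.pi fun _ : ι => ν).real B := by
  classical
  have hind : iIndepFun (fun (i : ι) (ω : ι → α) => ω i) (Measure.pi fun _ : ι => ν) :=
    iIndepFun_pi (X := fun _ x => x) fun _ => aemeasurable_id
  have hdisj : Disjoint s.toFinset t.toFinset := Set.disjoint_toFinset.2 hst
  have h := hind.indepFun_finset s.toFinset t.toFinset hdisj fun i => measurable_pi_apply i
  have key : ∀ {r : Set ι} {C : Set (ι → α)}, DependsOn (· ∈ C) r →
      C = (fun (ω : ι → α) (i : r.toFinset) => ω i) ⁻¹'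
        ((fun (ω : ι → α) (i : r.toFinset) => ω i) '' C) := by
    intro r C hC
    refine Set.Subset.antisymm (Set.subset_preimage_image _ _) ?_
    rintro ω ⟨ω', hω', he⟩
    have : (ω' ∈ C) = (ω ∈ C) := hC fun i hi => congrFun he ⟨i, Set.mem_toFinset.2 hi⟩
    exact this ▸ hω'
  have := h.measure_inter_preimage_eq_mul
    ((fun (ω : ι → α) (i : s.toFinset) => ω i) '' A)
    ((fun (ω : ι → α) (i : t.toFinset) => ω i) '' B)
    (Set.toFinite _).measurableSet (Set.toFinite _).measurableSet
  rw [← key hA, ← key hB] at this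
  simp only [measureReal_def, this, ENNReal.toReal_mul]

end ProductMeasure

section BernoulliEdges

theorem isProbabilityMeasure_bernoulliBool {p : ℝ} (h0 : 0 ≤ p) (h1 : p ≤ 1) :
    IsProbabilityMeasure (bernoulliBool p) := by
  constructor
  simp only [bernoulliBool, Measure.add_apply, Measure.smul_apply, measure_univ]
  rw [ENNReal.smul_def, ENNReal.smul_def, smul_eq_mul, smul_eq_mul, mul_one, mul_one,
    ← ENNReal.coe_add, ← Real.toNNReal_add h0 (sub_nonneg.2 h1)]
  simp

theorem bernoulliBool_real_true {p : ℝ} (h0 : 0 ≤ p) :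
    (bernoulliBool p).real {true} = p := by
  simp [bernoulliBool, measureReal_def, h0]

theorem bernoulliBool_real_false {p : ℝ} (h1 : p ≤ 1) :
    (bernoulliBool p).real {false} = 1 - p := by
  simp [bernoulliBool, measureReal_def, h1]

theorem isProbabilityMeasure_erMeasure (n : ℕ) {p : ℝ} (h0 : 0 ≤ p) (h1 : p ≤ 1) :
    IsProbabilityMeasure (erMeasure n p) := by
  have := isProbabilityMeasure_bernoulliBool h0 h1
  unfold erMeasure
  infer_instance

theorem erMeasure_real_inter_eq_mul {n : ℕ} {p : ℝ} (h0 : 0 ≤ p) (h1 : p ≤ 1)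
    {s t : Set (Sym2 (Fin n))} (hst : Disjoint s t) {A B : Set (Sym2 (Fin n) → Bool)}
    (hA : DependsOn (· ∈ A) s) (hB : DependsOn (· ∈ B) t) :
    (erMeasure n p).real (A ∩ B) = (erMeasure n p).real A * (erMeasure n p).real B := by
  have := isProbabilityMeasure_bernoulliBool h0 h1
  exact pi_real_inter_eq_mul _ hst hA hB

theorem erMeasure_real_edge {n : ℕ} {p : ℝ} (h0 : 0 ≤ p) (h1 : p ≤ 1) (e : Sym2 (Fin n))
    (b : Bool) :
    (erMeasure n p).real {ω | ω e = b} = if b = true then p else 1 - p := by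
  have := isProbabilityMeasure_bernoulliBool h0 h1
  have h := (measurePreserving_eval (fun _ : Sym2 (Fin n) => bernoulliBool p) e).measureReal_preimage
    (s := {b}) (MeasurableSet.of_discrete).nullMeasurableSet
  have h2 : (erMeasure n p).real {ω | ω e = b} = (bernoulliBool p).real {b} := h
  rw [h2]
  cases b
  · simpa using bernoulliBool_real_false h1
  · simpa using bernoulliBool_real_true h0

theorem erMeasure_real_filter_eq {n : ℕ} {p : ℝ} (h0 : 0 ≤ p) (h1 : p ≤ 1) (u : Fin n)
    (U N : Finset (Fin n)) (hN : N ⊆ U) :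
    (erMeasure n p).real {ω | U.filter (fun v => ω s(u, v) = true) = N} =
      p ^ N.card * (1 - p) ^ (U.card - N.card) := by
  have := isProbabilityMeasure_erMeasure n h0 h1
  induction U using Finset.induction_on generalizing N with
  | empty =>
    obtain rfl := Finset.subset_empty.1 hN
    simp
  | insert v U hv ih =>
    have hset : {ω : Sym2 (Fin n) → Bool |
          (insert v U).filter (fun w => ω s(u, w) = true) = N} =
        {ω | ω s(u, v) = decide (v ∈ N)} ∩
          {ω | U.filter (fun w => ω s(u, w) = true) = N.erase v} := by
      ext ω
      simp only [Set.mem_ofPred_eq, Set.mem_inter_iff, Finset.ext_iff, Finset.mem_filter,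
        Finset.mem_insert, Finset.mem_erase]
      constructor
      · intro h
        refine ⟨?_, fun w => ?_⟩
        · have := h v
          rw [Bool.eq_iff_iff]
          simpa using this
        · have := h w
          by_cases hw : w = v
          · subst hw; simp [hv]
          · simpa [hw] using this
      · rintro ⟨h, h'⟩ w
        by_cases hw : w = v
        · subst hw; simp [h]
        · simpa [hw] using h' w
    have hdisj : Disjoint ({s(u, v)} : Set (Sym2 (Fin n))) ((fun w => s(u, w)) '' (U : Set (Fin n))) := by
      rw [Set.disjoint_singleton_left]
      rintro ⟨w, hw, he⟩
      have : w = v := Sym2.congr_right.1 he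
      exact hv (this ▸ hw)
    rw [hset, erMeasure_real_inter_eq_mul h0 h1 hdisj, erMeasure_real_edge h0 h1,
      ih (N.erase v) (by rw [← Finset.subset_insert_iff]; exact hN),
      Finset.card_insert_of_notMem hv]
    · by_cases hvN : v ∈ N
      · have hc := Finset.card_erase_add_one hvN
        simp only [hvN, decide_true, if_true]
        rw [← hc, Nat.add_sub_add_right, pow_succ]
        ring
      · have hle : N.card ≤ U.card := Finset.card_le_card fun w hw =>
          (Finset.mem_insert.1 (hN hw)).resolve_left fun h => hvN (h ▸ hw)
        simp only [hvN, decide_false, Finset.erase_eq_of_notMem hvN, Nat.succ_sub hle, pow_succ]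
        simp
        ring
    · intro ω ω' h
      simp [h _ rfl]
    · intro ω ω' h
      have : U.filter (fun w => ω s(u, w) = true) = U.filter (fun w => ω' s(u, w) = true) :=
        Finset.filter_congr fun w hw => by rw [h _ ⟨w, hw, rfl⟩]
      simp [this]

/-- The expectation of a cubic polynomial of the size of a `p`-random subset. -/
theorem sum_powerset_cubic {α : Type*} [DecidableEq α] (U : Finset α) (p c₀ c₁ c₂ c₃ : ℝ) :
    ∑ N ∈ U.powerset, p ^ N.card * (1 - p) ^ (U.card - N.card) *
        (c₀ + c₁ * N.card + c₂ * (N.card : ℝ) ^ 2 + c₃ * (N.card : ℝ) ^ 3) =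
      c₀ + c₁ * (U.card * p) + c₂ * (U.card * p + U.card * (U.card - 1) * p ^ 2) +
        c₃ * (U.card * p + 3 * (U.card * (U.card - 1) * p ^ 2) +
          U.card * (U.card - 1) * (U.card - 2) * p ^ 3) := by
  induction U using Finset.induction_on generalizing c₀ c₁ c₂ c₃ with
  | empty => simp
  | insert v U hv ih =>
    rw [Finset.sum_powerset_insert hv]
    have e1 : ∀ N ∈ U.powerset, p ^ N.card * (1 - p) ^ ((insert v U).card - N.card) *
          (c₀ + c₁ * N.card + c₂ * (N.card : ℝ) ^ 2 + c₃ * (N.card : ℝ) ^ 3) =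
        (1 - p) * (p ^ N.card * (1 - p) ^ (U.card - N.card) *
          (c₀ + c₁ * N.card + c₂ * (N.card : ℝ) ^ 2 + c₃ * (N.card : ℝ) ^ 3)) := by
      intro N hN
      rw [Finset.card_insert_of_notMem hv,
        Nat.succ_sub (Finset.card_le_card (Finset.mem_powerset.1 hN)), pow_succ]
      ring
    have e2 : ∀ N ∈ U.powerset, p ^ (insert v N).card *
          (1 - p) ^ ((insert v U).card - (insert v N).card) *
          (c₀ + c₁ * (insert v N).card + c₂ * ((insert v N).card : ℝ) ^ 2 +
            c₃ * ((insert v N).card : ℝ) ^ 3) =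
        p * (p ^ N.card * (1 - p) ^ (U.card - N.card) *
          ((c₀ + c₁ + c₂ + c₃) + (c₁ + 2 * c₂ + 3 * c₃) * N.card +
            (c₂ + 3 * c₃) * (N.card : ℝ) ^ 2 + c₃ * (N.card : ℝ) ^ 3)) := by
      intro N hN
      rw [Finset.card_insert_of_notMem hv,
        Finset.card_insert_of_notMem fun h => hv (Finset.mem_powerset.1 hN h),
        Nat.add_sub_add_right, pow_succ]
      push_cast
      ring
    rw [Finset.sum_congr rfl e1, Finset.sum_congr rfl e2, ← Finset.mul_sum, ← Finset.mul_sum,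
      ih, ih, Finset.card_insert_of_notMem hv]
    push_cast
    ring

end BernoulliEdges

section SurvivalBound

/-- A cubic in the number `y` of active vertices; with suitable coefficients it is a lower bound
for the probability that an excursion of the exploration process survives. -/
def survivalCubic (α ε b a y : ℝ) : ℝ := a * (ε * y + α * (ε * y) ^ 2) - b * (ε * y) ^ 3

theorem survivalCubic_zero (α ε b a : ℝ) : survivalCubic α ε b a 0 = 0 := by
  simp [survivalCubic]

/-- The survival cubic is a subsolution of the one-step equation of a random walk with steps
`Bin(m, p) - 1` whose drift is at most `C * ε` in absolute value. -/
theorem survivalCubic_le_sum_powerset {α : Type*} [DecidableEq α] (U : Finset α)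
    {p C ε a b y : ℝ} (hp0 : 0 ≤ p) (hp : p ≤ 1 / 4) (hC : 1 ≤ C) (hε : 0 ≤ ε)
    (hε' : ε ≤ 1 / 20) (hCε : C * ε ≤ 1 / 4) (hd : |U.card * p - 1| ≤ C * ε)
    (hb : 0 ≤ b) (hba : b ≤ a) (hy : 0 ≤ y) :
    survivalCubic (2 * C + 2) ε b ((1 - (2 * (2 * C + 2) * C + 6) * ε ^ 2) * a) y ≤
      ∑ N ∈ U.powerset, p ^ N.card * (1 - p) ^ (U.card - N.card) *
        survivalCubic (2 * C + 2) ε b a (y - 1 + N.card) := by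
  set A := 2 * C + 2 with hA
  set m := (U.card : ℝ) * p with hm
  have hexp : ∀ j : ℝ, survivalCubic A ε b a (y - 1 + j) =
      survivalCubic A ε b a (y - 1) +
      (a * (ε + 2 * A * ε ^ 2 * (y - 1)) - b * ε ^ 3 * (3 * (y - 1) ^ 2)) * j +
      (a * A * ε ^ 2 - b * ε ^ 3 * (3 * (y - 1))) * j ^ 2 + (- b * ε ^ 3) * j ^ 3 := by
    intro j; unfold survivalCubic; ring
  simp only [hexp]
  rw [sum_powerset_cubic]
  have hm3 : (U.card : ℝ) * (U.card - 1) * (U.card - 2) * p ^ 3 ≤ m ^ 3 := by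
    have : (U.card : ℝ) * (U.card - 1) * (U.card - 2) ≤ (U.card : ℝ) ^ 3 := by
      rcases Nat.eq_zero_or_pos U.card with h | h
      · simp [h]
      · have : (1 : ℝ) ≤ U.card := by exact_mod_cast h
        nlinarith
    rw [hm, mul_pow]
    exact mul_le_mul_of_nonneg_right this (by positivity)
  obtain ⟨hd1, hd2⟩ := abs_le.1 hd
  have hml : 3 / 4 ≤ m := by linarith
  have hmu : m ≤ 5 / 4 := by linarith
  have hmm : (U.card : ℝ) * (U.card - 1) * p ^ 2 = m ^ 2 - m * p := by rw [hm]; ring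
  rw [hmm]
  set q := (U.card : ℝ) * (U.card - 1) * (U.card - 2) * p ^ 3
  obtain ⟨d, hdm⟩ : ∃ d, d = m - 1 := ⟨_, rfl⟩
  obtain ⟨M2, hM2⟩ : ∃ M2, M2 = d ^ 2 + m * (1 - p) := ⟨_, rfl⟩
  obtain ⟨M3, hM3⟩ : ∃ M3, M3 = (m + 3 * (m ^ 2 - m * p) + q) - 3 * (m + m ^ 2 - m * p) +
    3 * m - 1 := ⟨_, rfl⟩
  have hM2l : 1 / 2 ≤ M2 := by nlinarith [sq_nonneg d]
  have hM2u : M2 ≤ 2 := by nlinarith [sq_nonneg d]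
  have hM3u : M3 ≤ 20 := by
    have : m ^ 3 ≤ (5 / 4) ^ 3 := pow_le_pow_left₀ (by linarith) hmu 3
    have : M3 = m + q - 1 := by rw [hM3]; ring
    norm_num at *
    linarith
  rw [← hdm] at hd1 hd2
  have ha : 0 ≤ a := hb.trans hba
  obtain ⟨x, hx⟩ : ∃ x, x = ε * y := ⟨_, rfl⟩
  have hx0 : 0 ≤ x := hx ▸ mul_nonneg hε hy
  have key : 0 ≤ a * (ε * d + 2 * A * ε * x * d + A * ε ^ 2 * M2) -
      b * (3 * x ^ 2 * ε * d + 3 * x * ε ^ 2 * M2 + ε ^ 3 * M3) +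
      (2 * A * C + 6) * ε ^ 2 * a * (x + A * x ^ 2) := by
    have hε2 : 0 ≤ ε ^ 2 := sq_nonneg ε
    have h1 : ε ^ 2 * (- C) ≤ ε * d := by linarith [mul_le_mul_of_nonneg_left hd1 hε]
    have h1' : ε * d ≤ ε ^ 2 * C := by linarith [mul_le_mul_of_nonneg_left hd2 hε]
    have h2 : ε ^ 2 * (- (2 * A * C * x)) ≤ 2 * A * ε * x * d := by
      linarith [mul_le_mul_of_nonneg_left h1 (by positivity : 0 ≤ 2 * A * x)]
    have h3 : ε ^ 2 * (A / 2) ≤ A * ε ^ 2 * M2 := by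
      linarith [mul_le_mul_of_nonneg_left hM2l (by positivity : 0 ≤ A * ε ^ 2)]
    have h4 : 3 * x ^ 2 * ε * d ≤ ε ^ 2 * (3 * C * x ^ 2) := by
      linarith [mul_le_mul_of_nonneg_left h1' (by positivity : 0 ≤ 3 * x ^ 2)]
    have h5 : 3 * x * ε ^ 2 * M2 ≤ ε ^ 2 * (6 * x) := by
      linarith [mul_le_mul_of_nonneg_left hM2u (by positivity : 0 ≤ 3 * x * ε ^ 2)]
    have h6 : ε ^ 3 * M3 ≤ ε ^ 2 * 1 := by
      have : ε * M3 ≤ 1 := by linarith [mul_le_mul_of_nonneg_left hM3u hε]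
      calc ε ^ 3 * M3 = ε ^ 2 * (ε * M3) := by ring
        _ ≤ _ := mul_le_mul_of_nonneg_left this hε2
    have h7 : ε ^ 2 * (-C - 2 * A * C * x + A / 2) * a ≤
        a * (ε * d + 2 * A * ε * x * d + A * ε ^ 2 * M2) := by
      rw [mul_comm a]
      exact mul_le_mul_of_nonneg_right (by linarith) ha
    have h8 : b * (3 * x ^ 2 * ε * d + 3 * x * ε ^ 2 * M2 + ε ^ 3 * M3) ≤
        a * (ε ^ 2 * (3 * C * x ^ 2 + 6 * x + 1)) :=
      (mul_le_mul_of_nonneg_left (by linarith) hb).trans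
        (mul_le_mul_of_nonneg_right hba (by positivity))
    have h9 : 0 ≤ ε ^ 2 * a * (-C - 2 * A * C * x + A / 2 - (3 * C * x ^ 2 + 6 * x + 1) +
        (2 * A * C + 6) * (x + A * x ^ 2)) := by
      have he : -C - 2 * A * C * x + A / 2 - (3 * C * x ^ 2 + 6 * x + 1) +
          (2 * A * C + 6) * (x + A * x ^ 2) = ((2 * A * C + 6) * A - 3 * C) * x ^ 2 := by
        rw [hA]; ring
      rw [he]
      have : 0 ≤ (2 * A * C + 6) * A - 3 * C := by nlinarith [mul_nonneg (by positivity : 0 ≤ A * C) (by linarith : 0 ≤ A)]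
      positivity
    linarith
  rw [← sub_nonneg]
  convert key using 1
  unfold survivalCubic
  rw [hM3, hM2, hdm, hx]
  ring

end SurvivalBound

section Exploration

variable {n : ℕ}

/-- The exploration started from the state `st` has an active vertex at the end of each of its
first `k` steps. -/
def erAlive (ω : Sym2 (Fin n) → Bool) : ℕ → Finset (Fin n) × Finset (Fin n) → Prop
  | 0, _ => True
  | k + 1, st => (erStep ω st).1.Nonempty ∧ erAlive ω k (erStep ω st)

theorem exists_erStep_eq {st : Finset (Fin n) × Finset (Fin n)} (hst : Disjoint st.1 st.2)
    (hne : st.1.Nonempty ∨ st.2 ≠ Finset.univ) :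
    ∃ (u : Fin n) (U A : Finset (Fin n)), u ∉ st.2 ∧ u ∉ A ∧ Disjoint A st.2 ∧ u ∉ U ∧
      Disjoint U st.2 ∧ Disjoint A U ∧ A.card = st.1.card - 1 ∧
      U.card + A.card + st.2.card + 1 = n ∧
      ∀ ω, erStep ω st = (A ∪ U.filter fun v => ω s(u, v) = true, insert u st.2) := by
  have hcompl : (Finset.univ \ (st.1 ∪ st.2)).card + st.1.card + st.2.card = n := by
    rw [add_assoc, ← Finset.card_union_of_disjoint hst,
      Finset.card_sdiff_add_card_eq_card (Finset.subset_univ _), Finset.card_univ,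
      Fintype.card_fin]
  by_cases hA : st.1.Nonempty
  · have hu := st.1.min'_mem hA
    have hc := Finset.card_erase_add_one hu
    refine ⟨st.1.min' hA, Finset.univ \ (st.1 ∪ st.2), st.1.erase (st.1.min' hA),
      Finset.disjoint_left.1 hst hu, Finset.notMem_erase _ _,
      hst.mono_left (Finset.erase_subset _ _), by simp [hu], ?_, ?_,
      Finset.card_erase_of_mem hu, by omega, fun ω => by rw [erStep, dif_pos hA]⟩
    · exact Finset.disjoint_left.2 fun v hv hv' => by simp [hv'] at hv
    · exact Finset.disjoint_left.2 fun v hv hv' => by simp [Finset.mem_of_mem_erase hv] at hv'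
  · have hE : st.2 ≠ Finset.univ := hne.resolve_left hA
    have hA0 : st.1 = ∅ := Finset.not_nonempty_iff_eq_empty.1 hA
    have hU : (Finset.univ \ (st.1 ∪ st.2)).Nonempty := by
      rw [hA0, Finset.empty_union, Finset.sdiff_nonempty]
      exact fun h => hE (Finset.univ_subset_iff.1 h)
    have hu := (Finset.univ \ (st.1 ∪ st.2)).min'_mem hU
    set u := (Finset.univ \ (st.1 ∪ st.2)).min' hU with hu_def
    have hc := Finset.card_erase_add_one hu
    refine ⟨u, (Finset.univ \ (st.1 ∪ st.2)).erase u, ∅, ?_, by simp, by simp, by simp, ?_,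
      by simp, by simp [hA0], ?_, fun ω => ?_⟩
    · exact fun h => (Finset.mem_sdiff.1 hu).2 (Finset.mem_union_right _ h)
    · exact Finset.disjoint_left.2 fun v hv hv' => by simp [hv'] at hv
    · rw [hA0, Finset.card_empty] at hcompl
      rw [hA0] at hc ⊢
      simp only [Finset.card_empty]
      omega
    · rw [erStep, dif_neg hA]
      simp only [Finset.empty_union]
      rw [dif_pos hU]

theorem erStep_of_explored {st : Finset (Fin n) × Finset (Fin n)}
    (hne : ¬ (st.1.Nonempty ∨ st.2 ≠ Finset.univ)) (ω : Sym2 (Fin n) → Bool) :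
    erStep ω st = st := by
  push Not at hne
  rw [erStep, dif_neg (by simp [hne.1]), dif_neg (by simp [hne.2])]

theorem disjoint_erStep {st : Finset (Fin n) × Finset (Fin n)} (hst : Disjoint st.1 st.2)
    (ω : Sym2 (Fin n) → Bool) : Disjoint (erStep ω st).1 (erStep ω st).2 := by
  by_cases hne : st.1.Nonempty ∨ st.2 ≠ Finset.univ
  · obtain ⟨u, U, A, -, huA, hA, huU, hU, -, -, -, h⟩ := exists_erStep_eq hst hne
    rw [h, Finset.disjoint_insert_right, Finset.disjoint_union_left]
    exact ⟨by simp [huA, huU], hA, hU.mono_left (Finset.filter_subset _ _)⟩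
  · rwa [erStep_of_explored hne]

theorem erStep_congr_of_notMem {st : Finset (Fin n) × Finset (Fin n)} (hst : Disjoint st.1 st.2)
    {ω ω' : Sym2 (Fin n) → Bool}
    (h : ∀ e ∈ {e : Sym2 (Fin n) | ∀ v ∈ st.2, v ∉ e}, ω e = ω' e) :
    erStep ω st = erStep ω' st := by
  by_cases hne : st.1.Nonempty ∨ st.2 ≠ Finset.univ
  · obtain ⟨u, U, A, hu, -, -, -, hU, -, -, -, heq⟩ := exists_erStep_eq hst hne
    rw [heq, heq]
    congr 2
    refine Finset.filter_congr fun v hv => ?_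
    rw [h]
    intro w hw hwe
    rcases Sym2.mem_iff.1 hwe with rfl | rfl
    · exact hu hw
    · exact Finset.disjoint_left.1 hU hv hw
  · rw [erStep_of_explored hne, erStep_of_explored hne]

theorem erStep_congr_of_mem {st : Finset (Fin n) × Finset (Fin n)} (hst : Disjoint st.1 st.2)
    {ω ω' : Sym2 (Fin n) → Bool}
    (h : ∀ e ∈ {e : Sym2 (Fin n) | ∃ v ∈ (erStep ω st).2, v ∈ e}, ω e = ω' e) :
    erStep ω' st = erStep ω st := by
  by_cases hne : st.1.Nonempty ∨ st.2 ≠ Finset.univ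
  · obtain ⟨u, U, A, -, -, -, -, -, -, -, -, heq⟩ := exists_erStep_eq hst hne
    rw [heq] at h
    rw [heq, heq]
    congr 2
    refine Finset.filter_congr fun v hv => ?_
    rw [h s(u, v) ⟨u, Finset.mem_insert_self _ _, Sym2.mem_mk_left _ _⟩]
  · rw [erStep_of_explored hne, erStep_of_explored hne]

theorem subset_erStep {st : Finset (Fin n) × Finset (Fin n)} (hst : Disjoint st.1 st.2)
    (ω : Sym2 (Fin n) → Bool) : st.2 ⊆ (erStep ω st).2 := by
  by_cases hne : st.1.Nonempty ∨ st.2 ≠ Finset.univ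
  · obtain ⟨u, U, A, -, -, -, -, -, -, -, -, heq⟩ := exists_erStep_eq hst hne
    rw [heq]
    exact Finset.subset_insert _ _
  · rw [erStep_of_explored hne]

theorem card_erStep_le {st : Finset (Fin n) × Finset (Fin n)} (hst : Disjoint st.1 st.2)
    (ω : Sym2 (Fin n) → Bool) : (erStep ω st).2.card ≤ st.2.card + 1 := by
  by_cases hne : st.1.Nonempty ∨ st.2 ≠ Finset.univ
  · obtain ⟨u, U, A, -, -, -, -, -, -, -, -, heq⟩ := exists_erStep_eq hst hne
    rw [heq]
    exact Finset.card_insert_le _ _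
  · rw [erStep_of_explored hne]
    exact Nat.le_succ _

theorem dependsOn_erAlive (k : ℕ) {st : Finset (Fin n) × Finset (Fin n)}
    (hst : Disjoint st.1 st.2) :
    DependsOn (fun ω => erAlive ω k st) {e : Sym2 (Fin n) | ∀ v ∈ st.2, v ∉ e} := by
  induction k generalizing st with
  | zero => intro ω ω' _; rfl
  | succ k ih =>
    intro ω ω' h
    have hs := erStep_congr_of_notMem hst h
    simp only [erAlive]
    rw [← hs]
    have : erAlive ω k (erStep ω st) = erAlive ω' k (erStep ω st) :=
      ih (disjoint_erStep hst ω) fun e he => h e fun v hv => he v (subset_erStep hst ω hv)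
    rw [this]

theorem disjoint_erState (ω : Sym2 (Fin n) → Bool) (t : ℕ) :
    Disjoint (erState ω t).1 (erState ω t).2 := by
  induction t with
  | zero => simp [erState]
  | succ t ih => exact disjoint_erStep ih ω

theorem erState_explored_mono (ω : Sym2 (Fin n) → Bool) : Monotone fun t => (erState ω t).2 :=
  monotone_nat_of_le_succ fun t => subset_erStep (disjoint_erState ω t) ω

theorem card_erState_explored_le (ω : Sym2 (Fin n) → Bool) (t : ℕ) :
    (erState ω t).2.card ≤ t := by
  induction t with
  | zero => simp [erState]
  | succ t ih => exact (card_erStep_le (disjoint_erState ω t) ω).trans (by omega)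

theorem erState_congr {ω ω' : Sym2 (Fin n) → Bool} {t : ℕ}
    (h : ∀ e ∈ {e : Sym2 (Fin n) | ∃ v ∈ (erState ω t).2, v ∈ e}, ω e = ω' e) :
    ∀ s ≤ t, erState ω' s = erState ω s := by
  intro s hs
  induction s with
  | zero => rfl
  | succ s ih =>
    have ih := ih (by omega)
    rw [erState, ih]
    refine erStep_congr_of_mem (disjoint_erState ω s) fun e ⟨v, hv, hve⟩ => h e ⟨v, ?_, hve⟩
    exact erState_explored_mono ω hs hv

theorem exists_erY_eq_zero (ω : Sym2 (Fin n) → Bool) (t : ℕ) : ∃ s, t < s ∧ erY ω s = 0 := by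
  by_contra! hcon
  have hgrow : ∀ m, m ≤ (erState ω (t + 1 + m)).2.card := by
    intro m
    induction m with
    | zero => exact Nat.zero_le _
    | succ m ih =>
      have hne : (erState ω (t + 1 + m)).1.Nonempty :=
        Finset.card_ne_zero.1 (hcon (t + 1 + m) (by omega))
      obtain ⟨u, U, A, hu, -, -, -, -, -, -, -, heq⟩ :=
        exists_erStep_eq (disjoint_erState ω (t + 1 + m)) (Or.inl hne)
      rw [← add_assoc, erState, heq, Finset.card_insert_of_notMem hu]
      omega
  have h1 := hgrow (n + 1)
  have h2 := Finset.card_le_univ (erState ω (t + 1 + (n + 1))).2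
  rw [Fintype.card_fin] at h2
  omega

theorem erHit_succ_spec (ω : Sym2 (Fin n) → Bool) (i : ℕ) :
    erHit ω i < erHit ω (i + 1) ∧ erY ω (erHit ω (i + 1)) = 0 :=
  Nat.sInf_mem (s := {t | erHit ω i < t ∧ erY ω t = 0}) (exists_erY_eq_zero ω _)

theorem erHit_congr {ω ω' : Sym2 (Fin n) → Bool} {t : ℕ}
    (h : ∀ s ≤ t, erState ω s = erState ω' s) (i : ℕ) (hi : erHit ω i ≤ t) :
    erHit ω' i = erHit ω i := by
  induction i with
  | zero => rfl
  | succ i ih =>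
    obtain ⟨hlt, hY⟩ := erHit_succ_spec ω i
    have hi' := ih (by omega)
    have hle : erHit ω' (i + 1) ≤ erHit ω (i + 1) :=
      Nat.sInf_le ⟨hi'.trans_lt hlt, by rw [erY, ← h _ hi]; exact hY⟩
    obtain ⟨hlt', hY'⟩ := erHit_succ_spec ω' i
    refine le_antisymm hle (Nat.sInf_le ⟨hi' ▸ hlt', ?_⟩)
    rw [erY, h _ (hle.trans hi)]
    exact hY'

theorem erY_ne_zero_of_erAlive {ω : Sym2 (Fin n) → Bool} {k : ℕ} {t : ℕ}
    (h : erAlive ω k (erState ω t)) : ∀ s, 1 ≤ s → s ≤ k → erY ω (t + s) ≠ 0 := by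
  induction k generalizing t with
  | zero => intro s h1 h2; omega
  | succ k ih =>
    intro s h1 h2
    rcases Nat.eq_or_lt_of_le h1 with rfl | h1
    · exact Finset.card_ne_zero.2 h.1
    · have := ih (t := t + 1) h.2 (s - 1) (by omega) (by omega)
      rwa [show t + 1 + (s - 1) = t + s by omega] at this

theorem le_erHit_sub_of_erAlive {ω : Sym2 (Fin n) → Bool} {k i : ℕ}
    (h : erAlive ω k (erState ω (erHit ω i))) :
    k + 1 ≤ erHit ω (i + 1) - erHit ω i := by
  obtain ⟨hlt, hY⟩ := erHit_succ_spec ω i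
  by_contra hcon
  refine erY_ne_zero_of_erAlive h (erHit ω (i + 1) - erHit ω i) (by omega) (by omega) ?_
  rwa [Nat.add_sub_cancel' hlt.le]

end Exploration

section Survival

variable {n : ℕ}

theorem exists_sum_powerset_le_erAlive {p : ℝ} (h0 : 0 ≤ p) (h1 : p ≤ 1) {k : ℕ}
    {st : Finset (Fin n) × Finset (Fin n)} (hst : Disjoint st.1 st.2)
    (hne : st.1.Nonempty ∨ st.2 ≠ Finset.univ) (f : ℕ → ℝ) (hf0 : f 0 ≤ 0)
    (hf : ∀ st' : Finset (Fin n) × Finset (Fin n), Disjoint st'.1 st'.2 → st'.1.Nonempty →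
      st'.2.card = st.2.card + 1 → f st'.1.card ≤ (erMeasure n p).real {ω | erAlive ω k st'}) :
    ∃ U : Finset (Fin n), U.card + (st.1.card - 1) + st.2.card + 1 = n ∧
      ∑ N ∈ U.powerset, p ^ N.card * (1 - p) ^ (U.card - N.card) *
        f (st.1.card - 1 + N.card) ≤ (erMeasure n p).real {ω | erAlive ω (k + 1) st} := by
  have := isProbabilityMeasure_erMeasure n h0 h1
  obtain ⟨u, U, A, hu, huA, hA, huU, hU, hAU, hAc, hUc, heq⟩ := exists_erStep_eq hst hne
  refine ⟨U, hAc ▸ hUc, ?_⟩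
  rw [← hAc, measureReal_eq_sum_inter_fiber (erMeasure n p)
    (fun ω => U.filter fun v => ω s(u, v) = true) U.powerset
    fun ω _ => Finset.mem_powerset.2 (Finset.filter_subset _ _)]
  refine Finset.sum_le_sum fun N hN => ?_
  have hNU := Finset.mem_powerset.1 hN
  have hcard : (A ∪ N).card = A.card + N.card :=
    Finset.card_union_of_disjoint (hAU.mono_right hNU)
  have hw : 0 ≤ p ^ N.card * (1 - p) ^ (U.card - N.card) :=
    mul_nonneg (pow_nonneg h0 _) (pow_nonneg (sub_nonneg.2 h1) _)
  by_cases hAN : (A ∪ N).Nonempty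
  · have hdisj : Disjoint (A ∪ N) (insert u st.2) := by
      rw [Finset.disjoint_insert_right, Finset.disjoint_union_left]
      exact ⟨by simpa [huA] using fun h => huU (hNU h), hA, hU.mono_left hNU⟩
    have hset : {ω | erAlive ω (k + 1) st} ∩
          (fun ω : Sym2 (Fin n) → Bool => U.filter fun v => ω s(u, v) = true) ⁻¹' {N} =
        {ω | U.filter (fun v => ω s(u, v) = true) = N} ∩
          {ω | erAlive ω k (A ∪ N, insert u st.2)} := by
      ext ω
      simp only [Set.mem_inter_iff, Set.mem_ofPred_eq, Set.mem_preimage, Set.mem_singleton_iff,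
        erAlive, heq]
      constructor
      · rintro ⟨⟨-, h⟩, rfl⟩; exact ⟨rfl, h⟩
      · rintro ⟨rfl, h⟩; exact ⟨⟨hAN, h⟩, rfl⟩
    have hedge : Disjoint ((fun w => s(u, w)) '' (U : Set (Fin n)))
        {e : Sym2 (Fin n) | ∀ v ∈ insert u st.2, v ∉ e} := by
      rw [Set.disjoint_left]
      rintro _ ⟨w, -, rfl⟩ he
      exact he u (Finset.mem_insert_self _ _) (Sym2.mem_mk_left _ _)
    rw [hset, erMeasure_real_inter_eq_mul h0 h1 hedge _ (dependsOn_erAlive k hdisj),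
      erMeasure_real_filter_eq h0 h1 u U N hNU, ← hcard]
    · exact mul_le_mul_of_nonneg_left
        (hf (A ∪ N, insert u st.2) hdisj hAN (Finset.card_insert_of_notMem hu)) hw
    · intro ω ω' h
      have : U.filter (fun w => ω s(u, w) = true) = U.filter (fun w => ω' s(u, w) = true) :=
        Finset.filter_congr fun w hw => by rw [h _ ⟨w, hw, rfl⟩]
      simp [this]
  · rw [← hcard, Finset.not_nonempty_iff_eq_empty.1 hAN, Finset.card_empty]
    exact (mul_nonpos_of_nonneg_of_nonpos hw hf0).trans measureReal_nonneg

theorem survivalCubic_le_erAlive {p C ε b a R κ : ℝ} {M K : ℕ} (hp0 : 0 ≤ p) (hp : p ≤ 1 / 4)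
    (hC : 1 ≤ C) (hε : 0 ≤ ε) (hε' : ε ≤ 1 / 20) (hCε : C * ε ≤ 1 / 4) (hb : 0 ≤ b)
    (hκ : κ = (2 * (2 * C + 2) * C + 6) * ε ^ 2)
    (hdrift : ∀ m y : ℕ, m ≤ n → n ≤ m + y + M → ε * y ≤ R → |m * p - 1| ≤ C * ε)
    (hba : ∀ k ≤ K, b ≤ (1 - κ) ^ k * a)
    (hR : ∀ k ≤ K, ∀ y : ℝ, R < ε * y →
      survivalCubic (2 * C + 2) ε b ((1 - κ) ^ k * a) y ≤ 0)
    (hmax : ∀ y : ℝ, 0 ≤ y → survivalCubic (2 * C + 2) ε b a y ≤ 1)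
    {k : ℕ} (hk : k ≤ K) {st : Finset (Fin n) × Finset (Fin n)} (hst : Disjoint st.1 st.2)
    (hne : st.1.Nonempty ∨ st.2 ≠ Finset.univ) (hM : st.2.card + k ≤ M) :
    survivalCubic (2 * C + 2) ε b ((1 - κ) ^ k * a) ((st.1.card - 1 : ℕ) + 1) ≤
      (erMeasure n p).real {ω | erAlive ω k st} := by
  have hp1 : p ≤ 1 := hp.trans (by norm_num)
  have := isProbabilityMeasure_erMeasure n hp0 hp1
  induction k generalizing st with
  | zero =>
    have : {ω : Sym2 (Fin n) → Bool | erAlive ω 0 st} = Set.univ :=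
      Set.eq_univ_of_forall fun _ => trivial
    rw [this, probReal_univ, pow_zero, one_mul]
    exact hmax _ (by positivity)
  | succ k ih =>
    set y := st.1.card - 1 with hy
    rcases le_or_gt (ε * ((y : ℝ) + 1)) R with hyR | hyR
    · obtain ⟨U, hU, hle⟩ := exists_sum_powerset_le_erAlive hp0 hp1 (k := k) hst hne
        (fun j => survivalCubic (2 * C + 2) ε b ((1 - κ) ^ k * a) j)
        (by simp [survivalCubic_zero]) fun st' hst' hne' hc => by
          have := ih (by omega) hst' (Or.inl hne') (by omega)
          have hpos := Finset.card_pos.2 hne'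
          rwa [← Nat.cast_add_one, Nat.sub_add_cancel hpos] at this
      refine le_trans ?_ hle
      have hd : |U.card * p - 1| ≤ C * ε :=
        hdrift U.card (y + 1) (by omega) (by omega) (by push_cast; exact hyR)
      have := survivalCubic_le_sum_powerset U hp0 hp hC hε hε' hCε hd hb
        (hba k (by omega)) (y := (y : ℝ) + 1) (by positivity)
      rw [← hκ, ← mul_assoc, ← pow_succ'] at this
      refine this.trans_eq (Finset.sum_congr rfl fun N _ => ?_)
      rw [add_sub_cancel_right, Nat.cast_add]
    · exact (hR _ hk _ hyR).trans measureReal_nonneg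

end Survival

section StoppedSigmaAlgebra

theorem measurableSet_inter_of_sigmaAt {Ω : Type*} {F : ℕ → MeasurableSpace Ω} {τ : Ω → ℕ}
    (hτ : ∀ t, MeasurableSet[F t] {ω | τ ω ≤ t}) {s : Set Ω}
    (hs : MeasurableSet[sigmaAt F τ] s) (t : ℕ) : MeasurableSet[F t] (s ∩ {ω | τ ω ≤ t}) := by
  induction s, hs using MeasurableSpace.generateFrom_induction with
  | hC s hs _ => exact hs t
  | empty => simp
  | compl s _ ih =>
    have : sᶜ ∩ {ω | τ ω ≤ t} = {ω | τ ω ≤ t} \ (s ∩ {ω | τ ω ≤ t}) := by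
      ext ω; simp only [Set.mem_inter_iff, Set.mem_compl_iff, Set.mem_sdiff]; tauto
    rw [this]
    exact (hτ t).diff ih
  | iUnion s _ ih =>
    rw [Set.iUnion_inter]
    exact MeasurableSet.iUnion ih

theorem measurableSet_sigmaAt_le {Ω : Type*} {F : ℕ → MeasurableSpace Ω} (hF : Monotone F)
    {τ : Ω → ℕ} (hτ : ∀ t, MeasurableSet[F t] {ω | τ ω ≤ t}) (K : ℕ) :
    MeasurableSet[sigmaAt F τ] {ω | τ ω ≤ K} := by
  refine MeasurableSpace.measurableSet_generateFrom fun t => ?_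
  have : {ω | τ ω ≤ K} ∩ {ω | τ ω ≤ t} = {ω | τ ω ≤ min K t} := by
    ext ω; simp
  rw [this]
  exact hF (min_le_right K t) _ (hτ _)

theorem measurableSet_erF_iff {n t : ℕ} {s : Set (Sym2 (Fin n) → Bool)} :
    MeasurableSet[erF n t] s ↔
      ∀ ω ω', (∀ r ≤ t, erState ω r = erState ω' r) → ω ∈ s → ω' ∈ s := by
  constructor
  · rintro ⟨S, -, rfl⟩ ω ω' h hω
    have : (fun r : Fin (t + 1) => erState ω r) = fun r : Fin (t + 1) => erState ω' r :=
      funext fun r => h r (Nat.lt_succ_iff.1 r.2)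
    rw [Set.mem_preimage, this] at hω
    exact hω
  · intro h
    refine ⟨(fun ω => fun r : Fin (t + 1) => erState ω r) '' s, trivial, ?_⟩
    refine Set.Subset.antisymm ?_ (Set.subset_preimage_image _ _)
    rintro ω ⟨ω', hω', he⟩
    exact h ω' ω (fun r hr => congrFun he ⟨r, Nat.lt_succ_iff.2 hr⟩) hω'

theorem monotone_erF (n : ℕ) : Monotone (erF n) := fun _ _ hst _ hs =>
  measurableSet_erF_iff.2 fun ω ω' h =>
    measurableSet_erF_iff.1 hs ω ω' fun r hr => h r (hr.trans hst)

theorem measurableSet_erHit_le (n i t : ℕ) :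
    MeasurableSet[erF n t] {ω : Sym2 (Fin n) → Bool | erHit ω i ≤ t} :=
  measurableSet_erF_iff.2 fun _ _ h hω => (erHit_congr h i hω).trans_le hω

theorem dependsOn_mem_of_imp {ι : Type*} {α : ι → Type*} {A : Set ((i : ι) → α i)} {s : Set ι}
    (h : ∀ ω ω', (∀ i ∈ s, ω i = ω' i) → ω ∈ A → ω' ∈ A) : DependsOn (· ∈ A) s :=
  fun ω ω' he => propext ⟨h ω ω' he, h ω' ω fun i hi => (he i hi).symm⟩

/-- The strong Markov property at the end of an excursion, as an inequality. -/
theorem mul_real_le_real_inter_excursion {n : ℕ} {p c : ℝ} (h0 : 0 ≤ p) (h1 : p ≤ 1)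
    {i k K : ℕ} {S : Set (Sym2 (Fin n) → Bool)}
    (hS : MeasurableSet[sigmaAt (erF n) fun ω => erHit ω (i + 1)] S)
    (hSK : ∀ ω ∈ S, erHit ω (i + 1) ≤ K)
    (hc : ∀ E : Finset (Fin n), E.card ≤ K →
      c ≤ (erMeasure n p).real {ω | erAlive ω k (∅, E)}) :
    c * (erMeasure n p).real S ≤
      (erMeasure n p).real (S ∩ {ω | k + 1 ≤ erHit ω (i + 2) - erHit ω (i + 1)}) := by
  have := isProbabilityMeasure_erMeasure n h0 h1
  set Φ : (Sym2 (Fin n) → Bool) → ℕ × Finset (Fin n) := fun ω =>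
    (erHit ω (i + 1), (erState ω (erHit ω (i + 1))).2) with hΦ
  have hfib : ∀ ω ∈ S, Φ ω ∈ Finset.range (K + 1) ×ˢ (Finset.univ : Finset (Finset (Fin n))) :=
    fun ω hω => by simpa [hΦ, Nat.lt_succ_iff] using hSK ω hω
  rw [measureReal_eq_sum_inter_fiber (erMeasure n p) Φ _ hfib,
    measureReal_eq_sum_inter_fiber (erMeasure n p) Φ _ fun ω hω => hfib ω hω.1, Finset.mul_sum]
  refine Finset.sum_le_sum fun ⟨t, E⟩ _ => ?_
  rcases (S ∩ Φ ⁻¹' {(t, E)}).eq_empty_or_nonempty with hemp | ⟨ω₀, hω₀, hΦ₀⟩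
  · rw [hemp, measureReal_empty, mul_zero]
    exact measureReal_nonneg
  have hspec : ∀ ω ∈ Φ ⁻¹' {(t, E)}, erHit ω (i + 1) = t ∧ erState ω t = (∅, E) := by
    intro ω hω
    obtain ⟨ht, hE⟩ := Prod.mk.inj (show Φ ω = (t, E) from hω)
    have hY := (erHit_succ_spec ω i).2
    rw [ht] at hE hY
    exact ⟨ht, Prod.ext (Finset.card_eq_zero.1 hY) hE⟩
  have hE : E.card ≤ K := by
    obtain ⟨ht, hE⟩ := hspec ω₀ hΦ₀
    have := card_erState_explored_le ω₀ t
    rw [hE] at this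
    exact this.trans (ht ▸ hSK ω₀ hω₀)
  have hdep : DependsOn (· ∈ S ∩ Φ ⁻¹' {(t, E)}) {e : Sym2 (Fin n) | ∃ v ∈ E, v ∈ e} := by
    refine dependsOn_mem_of_imp fun ω ω' hag ⟨hωS, hωΦ⟩ => ?_
    obtain ⟨ht, hst⟩ := hspec ω hωΦ
    have hcongr : ∀ s ≤ t, erState ω s = erState ω' s := fun s hs =>
      (erState_congr (by rw [hst]; exact hag) s hs).symm
    have ht' : erHit ω' (i + 1) = t := (erHit_congr hcongr (i + 1) ht.le).trans ht
    refine ⟨(measurableSet_erF_iff.1 (measurableSet_inter_of_sigmaAt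
      (measurableSet_erHit_le n (i + 1)) hS t) ω ω' hcongr ⟨hωS, ht.le⟩).1, ?_⟩
    show Φ ω' = (t, E)
    simp only [hΦ, ht', ← hcongr t le_rfl, hst]
  have hdisj : Disjoint {e : Sym2 (Fin n) | ∃ v ∈ E, v ∈ e} {e | ∀ v ∈ E, v ∉ e} :=
    Set.disjoint_left.2 fun e ⟨v, hv, hve⟩ he => he v hv hve
  calc c * (erMeasure n p).real (S ∩ Φ ⁻¹' {(t, E)})
      ≤ (erMeasure n p).real (S ∩ Φ ⁻¹' {(t, E)}) *
          (erMeasure n p).real {ω | erAlive ω k (∅, E)} := by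
        rw [mul_comm]
        exact mul_le_mul_of_nonneg_left (hc E hE) measureReal_nonneg
    _ = (erMeasure n p).real (S ∩ Φ ⁻¹' {(t, E)} ∩ {ω | erAlive ω k (∅, E)}) :=
        (erMeasure_real_inter_eq_mul h0 h1 hdisj hdep
          (dependsOn_erAlive k (Finset.disjoint_empty_left E))).symm
    _ ≤ _ := by
        refine measureReal_mono fun ω ⟨⟨hωS, hωΦ⟩, hω⟩ => ⟨⟨hωS, ?_⟩, hωΦ⟩
        obtain ⟨ht, hst⟩ := hspec ω hωΦ
        refine le_erHit_sub_of_erAlive ?_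
        rw [ht, hst]
        exact hω

theorem ae_le_condExp_indicator {Ω : Type*} {m m₀ : MeasurableSpace Ω} {μ : Measure Ω}
    [IsProbabilityMeasure μ] (hm : m ≤ m₀) {D E : Set Ω} (hE : MeasurableSet[m₀] E)
    (hD : MeasurableSet[m] D) {c : ℝ}
    (h : ∀ S ⊆ D, MeasurableSet[m] S → c * μ.real S ≤ μ.real (S ∩ E)) :
    ∀ᵐ ω ∂μ, ω ∈ D → c ≤ (μ[E.indicator (fun _ => (1 : ℝ)) | m]) ω := by
  set f := μ[E.indicator (fun _ => (1 : ℝ)) | m] with hf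
  have hint : Integrable (E.indicator fun _ => (1 : ℝ)) μ := (integrable_const 1).indicator hE
  have hfm : Measurable[m] f := stronglyMeasurable_condExp.measurable
  set S := D ∩ {ω | f ω < c} with hS
  have hSm : MeasurableSet[m] S := hD.inter (hfm measurableSet_Iio)
  have hSint : ∫ ω in S, f ω ∂μ = μ.real (S ∩ E) := by
    rw [hf, setIntegral_condExp hm hint hSm, setIntegral_indicator hE]
    simp
  have hle := h S Set.inter_subset_left hSm
  have hpos : 0 ≤ᵐ[μ.restrict S] fun ω => c - f ω :=
    (ae_restrict_iff' (hm _ hSm)).2 (.of_forall fun ω hω => sub_nonneg.2 (le_of_lt hω.2))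
  have hci : IntegrableOn (fun ω => c - f ω) S μ :=
    ((integrable_const c).sub integrable_condExp).integrableOn
  have hint0 : ∫ ω in S, (c - f ω) ∂μ = 0 := by
    refine le_antisymm ?_ (integral_nonneg_of_ae hpos)
    rw [integral_sub (integrable_const c).integrableOn integrable_condExp.integrableOn, hSint]
    simp only [integral_const, measureReal_restrict_apply_univ, smul_eq_mul]
    linarith
  have h0 := (ae_restrict_iff' (hm _ hSm)).1 ((integral_eq_zero_iff_of_nonneg_ae hpos hci).1 hint0)
  filter_upwards [h0] with ω hω hωD
  by_contra hlt
  push Not at hlt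
  have := hω ⟨hωD, hlt⟩
  simp only [Pi.zero_apply] at this
  linarith

end StoppedSigmaAlgebra

section CriticalWindow

/-- An exploration whose drift is at most `C / √T` in absolute value, started without active
vertices, survives `T - 1` steps with probability at least `c / √T`. -/
theorem exists_le_real_erAlive {C : ℝ} (hC : 1 ≤ C) :
    ∃ c > (0 : ℝ), ∃ R > (0 : ℝ), ∃ δ > (0 : ℝ), C * δ ≤ 1 / 4 ∧ δ ≤ 1 / 20 ∧
      ∀ (n T M : ℕ) (p ε : ℝ), 1 ≤ T → ε = 1 / √(T : ℝ) → ε ≤ δ → 0 ≤ p → p ≤ 1 / 4 →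
        (∀ m y : ℕ, m ≤ n → n ≤ m + y + M → ε * y ≤ R → |m * p - 1| ≤ C * ε) →
        ∀ E : Finset (Fin n), E ≠ Finset.univ → E.card + (T - 1) ≤ M →
          c * ε ≤ (erMeasure n p).real {ω | erAlive ω (T - 1) (∅, E)} := by
  obtain ⟨α, hα⟩ : ∃ α, α = 2 * C + 2 := ⟨_, rfl⟩
  have hα0 : 0 ≤ α := by linarith
  obtain ⟨K, hK⟩ : ∃ K, K = 2 * α * C + 6 := ⟨_, rfl⟩
  have hKC : C ≤ K := by
    rw [hK, hα]
    nlinarith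
  have hK1 : 1 ≤ K := hC.trans hKC
  obtain ⟨β, hβ⟩ : ∃ β, β = Real.exp (-(2 * K)) := ⟨_, rfl⟩
  have hβ0 : 0 < β := hβ ▸ Real.exp_pos _
  obtain ⟨R, hR⟩ : ∃ R, R = (1 + α) / β + 1 := ⟨_, rfl⟩
  have hR1 : 1 ≤ R := by
    have : 0 ≤ (1 + α) / β := div_nonneg (by linarith) hβ0.le
    linarith
  have hβR : 1 + α ≤ β * R := by
    rw [hR, mul_add, mul_div_cancel₀ _ hβ0.ne']
    linarith
  have hden : 0 < R + α * R ^ 2 := by positivity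
  obtain ⟨a, ha⟩ : ∃ a, a = 1 / (R + α * R ^ 2) := ⟨_, rfl⟩
  have ha0 : 0 < a := ha ▸ one_div_pos.2 hden
  have ha1 : a * (R + α * R ^ 2) = 1 := by
    rw [ha, one_div_mul_cancel hden.ne']
  refine ⟨a * β, mul_pos ha0 hβ0, R, by linarith, 1 / (20 * K), by positivity, ?_, ?_, ?_⟩
  · rw [mul_one_div, div_le_div_iff₀ (by positivity) (by norm_num)]
    linarith
  · exact one_div_le_one_div_of_le (by norm_num) (by linarith)
  intro n T M p ε hT hε hεδ hp0 hp hdrift E hE hM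
  have hTpos : (0 : ℝ) < T := by exact_mod_cast hT
  have hε0 : 0 < ε := hε ▸ one_div_pos.2 (Real.sqrt_pos.2 hTpos)
  have hKε : K * ε ≤ 1 / 20 := by
    have := mul_le_mul_of_nonneg_left hεδ (by linarith : 0 ≤ K)
    rwa [show K * (1 / (20 * K)) = 1 / 20 by field_simp] at this
  have hε1 : ε ≤ 1 / 20 := by linarith [mul_le_mul_of_nonneg_right hK1 hε0.le]
  have hCε : C * ε ≤ 1 / 4 := by linarith [mul_le_mul_of_nonneg_right hKC hε0.le]
  have hεT : ε ^ 2 * T = 1 := by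
    rw [hε, div_pow, Real.sq_sqrt hTpos.le]
    field_simp
  obtain ⟨κ, hκ⟩ : ∃ κ, κ = K * ε ^ 2 := ⟨_, rfl⟩
  have hκ0 : 0 ≤ κ := by rw [hκ]; positivity
  have hκ1 : κ ≤ 1 / 2 := by
    rw [hκ]
    linarith [mul_le_mul_of_nonneg_right hKε hε0.le]
  have hκT : κ * T = K := by rw [hκ, mul_assoc, hεT, mul_one]
  have hexp : Real.exp (-(2 * κ)) ≤ 1 - κ := by
    rw [Real.exp_neg, inv_le_iff_one_le_mul₀ (Real.exp_pos _)]
    have h1 := mul_le_mul_of_nonneg_left (Real.add_one_le_exp (2 * κ))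
      (by linarith : 0 ≤ 1 - κ)
    have h2 := mul_nonneg hκ0 (by linarith : 0 ≤ 1 - 2 * κ)
    linarith
  have hpow : ∀ k ≤ T, β ≤ (1 - κ) ^ k := by
    intro k hk
    refine le_trans ?_ (pow_le_pow_left₀ (Real.exp_pos _).le hexp k)
    rw [← Real.exp_nat_mul, hβ, Real.exp_le_exp]
    have : (k : ℝ) ≤ T := by exact_mod_cast hk
    linarith [mul_le_mul_of_nonneg_left this hκ0]
  have hpow1 : ∀ k, (1 - κ) ^ k ≤ 1 := fun k => pow_le_one₀ (by linarith) (by linarith)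
  have hneg : ∀ k : ℕ, ∀ y : ℝ, R < ε * y →
      survivalCubic α ε (a * β) ((1 - κ) ^ k * a) y ≤ 0 := by
    intro k y hy
    unfold survivalCubic
    generalize ε * y = x at hy
    have hx1 : 1 ≤ x := hR1.trans hy.le
    have h1 : 1 + α * x ≤ β * x ^ 2 := by
      have : 1 + α ≤ β * x := hβR.trans (mul_le_mul_of_nonneg_left hy.le hβ0.le)
      linarith [mul_le_mul_of_nonneg_right this (by linarith : 0 ≤ x)]
    have h2 : (1 - κ) ^ k * a * (x + α * x ^ 2) ≤ a * (x + α * x ^ 2) :=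
      mul_le_mul_of_nonneg_right (mul_le_of_le_one_left ha0.le (hpow1 k))
        (by positivity)
    have h3 : a * x * (1 + α * x) ≤ a * x * (β * x ^ 2) :=
      mul_le_mul_of_nonneg_left h1 (by positivity)
    linarith
  have hmax : ∀ y : ℝ, 0 ≤ y → survivalCubic α ε (a * β) a y ≤ 1 := by
    intro y hy
    rcases lt_or_ge R (ε * y) with h | h
    · have := hneg 0 y h
      rw [pow_zero, one_mul] at this
      linarith
    · unfold survivalCubic
      have hx : 0 ≤ ε * y := by positivity
      generalize ε * y = x at h hx
      have hsq : x ^ 2 ≤ R ^ 2 := pow_le_pow_left₀ hx h 2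
      have : a * (x + α * x ^ 2) ≤ a * (R + α * R ^ 2) := by gcongr
      have : 0 ≤ a * β * x ^ 3 := by positivity
      linarith
  have hmain := survivalCubic_le_erAlive (n := n) (p := p) (C := C) (ε := ε) (b := a * β) (a := a)
    (R := R) (κ := κ) (M := M) (K := T) hp0 hp hC hε0.le hε1 hCε (by positivity)
    (by rw [hκ, hK, hα]) hdrift
    (fun k hk => by rw [mul_comm]; exact mul_le_mul_of_nonneg_right (hpow k hk) ha0.le)
    (fun k _ y hy => hα ▸ hneg k y hy) (fun y hy => hα ▸ hmax y hy)
    (k := T - 1) (Nat.sub_le _ _) (st := (∅, E)) (Finset.disjoint_empty_left E) (Or.inr hE) hM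
  refine le_trans ?_ hmain
  simp only [Finset.card_empty, Nat.zero_sub, Nat.cast_zero, zero_add, ← hα]
  unfold survivalCubic
  rw [mul_one]
  have h1 : β * a * (ε + α * ε ^ 2) ≤ (1 - κ) ^ (T - 1) * a * (ε + α * ε ^ 2) :=
    mul_le_mul_of_nonneg_right (mul_le_mul_of_nonneg_right (hpow _ (Nat.sub_le _ _)) ha0.le)
      (by positivity)
  have h2 : 0 ≤ a * β * ε ^ 2 * (α - ε) := mul_nonneg (by positivity) (by linarith)
  linarith

theorem mul_pER {n : ℕ} (hn : 0 < n) (lam : ℝ) :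
    (n : ℝ) * pER n lam = 1 + lam * (n : ℝ) ^ (-(1 / 3 : ℝ)) := by
  have : (n : ℝ) ≠ 0 := by exact_mod_cast hn.ne'
  rw [pER]
  field_simp

/-- The scale relations between `n`, `T` and `ε = 1 / √T`, when `T ≤ n ^ (2 / 3) + 1`. -/
theorem scale_bounds {n T : ℕ} {ε : ℝ} (hn : 0 < n) (hT : 1 ≤ T)
    (hTn : (T : ℝ) ≤ (n : ℝ) ^ ((2 : ℝ) / 3) + 1) (hε : ε = 1 / √(T : ℝ)) :
    (n : ℝ) ^ (-(1 / 3 : ℝ)) ≤ 2 * ε ∧ (T : ℝ) ≤ 8 * (n * ε) := by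
  have hn1 : (1 : ℝ) ≤ n := by exact_mod_cast hn
  have hTpos : (0 : ℝ) < T := by exact_mod_cast hT
  obtain ⟨x, hx⟩ : ∃ x, x = (n : ℝ) ^ (1 / 3 : ℝ) := ⟨_, rfl⟩
  have hx1 : 1 ≤ x := hx ▸ Real.one_le_rpow hn1 (by norm_num)
  have hx3 : x ^ 3 = n := by
    rw [hx, ← Real.rpow_natCast, ← Real.rpow_mul (by linarith)]
    norm_num
  have hx2 : (n : ℝ) ^ ((2 : ℝ) / 3) = x ^ 2 := by
    rw [hx, ← Real.rpow_natCast, ← Real.rpow_mul (by linarith)]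
    norm_num
  rw [Real.rpow_neg (by linarith), ← hx]
  rw [hx2] at hTn
  obtain ⟨q, hq⟩ : ∃ q, q = √(T : ℝ) := ⟨_, rfl⟩
  have hq0 : 0 < q := hq ▸ Real.sqrt_pos.2 hTpos
  have hqT : q ^ 2 = T := hq ▸ Real.sq_sqrt hTpos.le
  rw [← hq] at hε
  have hq2x : q ≤ 2 * x := by
    refine le_of_sq_le_sq ?_ (by linarith)
    nlinarith
  constructor
  · rw [hε, mul_one_div, inv_le_comm₀ (by linarith) (by positivity), inv_div]
    linarith
  · have : q ^ 3 ≤ (2 * x) ^ 3 := pow_le_pow_left₀ hq0.le hq2x 3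
    rw [hε, mul_one_div, ← hqT, ← mul_div_assoc, le_div_iff₀ hq0, ← hx3]
    linarith

theorem abs_drift_le {n T s : ℕ} {lam B R ε : ℝ} (hn : 0 < n) (hT : 1 ≤ T) (hε : ε = 1 / √(T : ℝ))
    (hnε : (n : ℝ) ^ (-(1 / 3 : ℝ)) ≤ 2 * ε) (hTε : (T : ℝ) ≤ 8 * (n * ε))
    (hs : (s : ℝ) ≤ B / 2 * (n * ε)) (hlam : 2 * |lam| * ε ≤ 1) (hR : 8 * R * ε ≤ 1) :
    ∀ m y : ℕ, m ≤ n → n ≤ m + y + (s + T) → ε * y ≤ R →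
      |m * pER n lam - 1| ≤ (2 * |lam| + B + 18) * ε := by
  intro m y hm hnm hy
  have hn0 : (0 : ℝ) < n := by exact_mod_cast hn
  have hTpos : (0 : ℝ) < T := by exact_mod_cast hT
  have hε0 : 0 < ε := hε ▸ one_div_pos.2 (Real.sqrt_pos.2 hTpos)
  have hεT : ε ^ 2 * T = 1 := by
    rw [hε, div_pow, Real.sq_sqrt hTpos.le]
    field_simp
  have hy' : (y : ℝ) ≤ n * ε := by
    have h1 : (y : ℝ) = ε * y * (ε * T) := by linear_combination (-(y : ℝ)) * hεT
    have h2 : ε * y * (ε * T) ≤ R * (ε * T) := mul_le_mul_of_nonneg_right hy (by positivity)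
    have h3 : 8 * R * ε * T ≤ 1 * T := mul_le_mul_of_nonneg_right hR hTpos.le
    linarith
  have hnp := mul_pER hn lam
  have hlam' : |lam * (n : ℝ) ^ (-(1 / 3 : ℝ))| ≤ 2 * |lam| * ε := by
    rw [abs_mul, abs_of_nonneg (Real.rpow_nonneg hn0.le _)]
    linarith [mul_le_mul_of_nonneg_left hnε (abs_nonneg lam)]
  obtain ⟨hl1, hl2⟩ := abs_le.1 hlam'
  have hp0 : 0 ≤ pER n lam := by
    refine nonneg_of_mul_nonneg_right (b := pER n lam) (a := (n : ℝ)) ?_ hn0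
    linarith
  have hnm' : (n : ℝ) - m ≤ (B / 2 + 9) * (n * ε) := by
    have : (n : ℝ) ≤ m + y + (s + T) := by exact_mod_cast hnm
    linarith
  have hloss : ((n : ℝ) - m) * pER n lam ≤ (B + 18) * ε := by
    have hB : 0 ≤ B / 2 + 9 := by
      have h0 : (0 : ℝ) ≤ n - m := sub_nonneg.2 (by exact_mod_cast hm)
      exact nonneg_of_mul_nonneg_left (h0.trans hnm') (by positivity)
    calc ((n : ℝ) - m) * pER n lam ≤ (B / 2 + 9) * (n * ε) * pER n lam :=
          mul_le_mul_of_nonneg_right hnm' hp0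
      _ = (B / 2 + 9) * ε * (n * pER n lam) := by ring
      _ ≤ (B / 2 + 9) * ε * 2 :=
          mul_le_mul_of_nonneg_left (by linarith) (mul_nonneg hB hε0.le)
      _ = _ := by ring
  have hgain : 0 ≤ ((n : ℝ) - m) * pER n lam :=
    mul_nonneg (sub_nonneg.2 (by exact_mod_cast hm)) hp0
  have habs := abs_nonneg lam
  rw [abs_le]
  constructor <;> nlinarith

end CriticalWindow

theorem long_excursion_conditional_lower_bound_ER (lam : ℝ) :
    ∃ B₀ > (0 : ℝ), ∃ A₀ > (0 : ℝ), ∀ B ≥ B₀, ∃ c₀ > (0 : ℝ), ∀ A : ℕ → ℝ,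
      (∀ n, A₀ ≤ A n) →
      A =o[atTop] (fun n : ℕ => (n : ℝ) ^ ((2 : ℝ) / 3)) →
      ∀ᶠ n : ℕ in atTop, ∀ i : ℕ,
        Lof n (A n) + 1 ≤ i → i ≤ 2 * Lof n (A n) →
        ∀ᵐ ω ∂ erMeasure n (pER n lam),
          (erHit ω (i - 1) : ℝ) ≤ B * (Lof n (A n) : ℝ) * Real.sqrt (Tof n (A n)) →
          c₀ / Real.sqrt (Tof n (A n)) ≤
            ((erMeasure n (pER n lam))[Set.indicator
                {ω' | Tof n (A n) ≤ erHit ω' i - erHit ω' (i - 1)} (fun _ => (1 : ℝ)) |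
              sigmaAt (erF n) fun ω' => erHit ω' (i - 1)]) ω := by
  refine ⟨1, one_pos, 1, one_pos, fun B hB => ?_⟩
  obtain ⟨C, hC⟩ : ∃ C, C = 2 * |lam| + B + 18 := ⟨_, rfl⟩
  have habs := abs_nonneg lam
  obtain ⟨c, hc, R, hR, δ, hδ, hCδ, hδ', hsurv⟩ :=
    exists_le_real_erAlive (C := C) (by linarith)
  refine ⟨c, hc, fun A hA hAo => ?_⟩
  obtain ⟨δ', hδ'def⟩ : ∃ δ', δ' = min δ (1 / (8 * R)) := ⟨_, rfl⟩
  have hδ'0 : 0 < δ' := hδ'def ▸ lt_min hδ (by positivity)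
  filter_upwards [hAo.def (c := δ' ^ 2) (by positivity), eventually_gt_atTop 0]
    with n hAn hn i hLi hiL
  have hn1 : (1 : ℝ) ≤ n := by exact_mod_cast hn
  have hA0 : 0 < A n := one_pos.trans_le (hA n)
  obtain ⟨N, hN⟩ : ∃ N, N = (n : ℝ) ^ ((2 : ℝ) / 3) := ⟨_, rfl⟩
  have hN0 : 0 < N := hN ▸ Real.rpow_pos_of_pos (by linarith) _
  rw [← hN, Real.norm_of_nonneg hA0.le, Real.norm_of_nonneg hN0.le] at hAn
  obtain ⟨T, hTdef⟩ : ∃ T, T = Tof n (A n) := ⟨_, rfl⟩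
  obtain ⟨L, hLdef⟩ : ∃ L, L = Lof n (A n) := ⟨_, rfl⟩
  have hTge : N / A n ≤ T := by rw [hTdef, Tof, ← hN]; exact Nat.le_ceil _
  have hTle : (T : ℝ) ≤ N + 1 := by
    rw [hTdef, Tof, ← hN]
    refine (Nat.ceil_lt_add_one (by positivity)).le.trans ?_
    linarith [div_le_self hN0.le (hA n)]
  have hTpos : (0 : ℝ) < T := (div_pos hN0 hA0).trans_le hTge
  have hT1 : 1 ≤ T := by exact_mod_cast hTpos
  have hTδ : 1 / δ' ^ 2 ≤ T := by
    refine le_trans ?_ hTge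
    rw [div_le_div_iff₀ (by positivity) hA0]
    linarith
  obtain ⟨ε, hε⟩ : ∃ ε, ε = 1 / √(T : ℝ) := ⟨_, rfl⟩
  have hsqrt : 0 < √(T : ℝ) := Real.sqrt_pos.2 hTpos
  have hε0 : 0 < ε := hε ▸ one_div_pos.2 hsqrt
  have hεδ' : ε ≤ δ' := by
    rw [hε, one_div_le hsqrt hδ'0]
    refine Real.le_sqrt_of_sq_le ?_
    rwa [one_div_pow]
  have hεδ : ε ≤ δ := hεδ'.trans (hδ'def ▸ min_le_left _ _)
  have hRε : 8 * R * ε ≤ 1 := by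
    have : ε ≤ 1 / (8 * R) := hεδ'.trans (hδ'def ▸ min_le_right _ _)
    rwa [le_div_iff₀ (by positivity), mul_comm] at this
  have hCε : C * ε ≤ 1 / 4 := (mul_le_mul_of_nonneg_left hεδ (by linarith)).trans hCδ
  have hlamε : 2 * |lam| * ε ≤ 1 / 4 := by
    refine le_trans (mul_le_mul_of_nonneg_right ?_ hε0.le) hCε
    linarith
  have hBε : B * ε ≤ 1 / 4 := by
    refine le_trans (mul_le_mul_of_nonneg_right ?_ hε0.le) hCε
    linarith
  obtain ⟨hnε, hTε⟩ := scale_bounds hn hT1 (hN ▸ hTle) hε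
  have hεsqrt : ε * √(T : ℝ) = 1 := by rw [hε]; field_simp
  obtain ⟨s, hsdef⟩ : ∃ s, s = ⌊B * (L : ℝ) * √(T : ℝ)⌋₊ := ⟨_, rfl⟩
  have hbound0 : 0 ≤ B * (L : ℝ) * √(T : ℝ) := by positivity
  have hs : (s : ℝ) ≤ B / 2 * (n * ε) := by
    rw [hsdef]
    refine (Nat.floor_le hbound0).trans ?_
    have hL : (L : ℝ) * (2 * T) ≤ n := by
      have : L * (2 * T) ≤ n := by
        rw [hLdef, Lof, ← hTdef]; exact Nat.div_mul_le_self _ _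
      exact_mod_cast this
    have hLT : (L : ℝ) * √(T : ℝ) ≤ n * ε / 2 := by
      have h1 : (L : ℝ) * √(T : ℝ) = L * (2 * T) * ε / 2 := by
        have := Real.mul_self_sqrt hTpos.le
        linear_combination (-(L : ℝ) * √(T : ℝ)) * hεsqrt + (L : ℝ) * ε * this
      rw [h1]
      linarith [mul_le_mul_of_nonneg_right hL hε0.le]
    linarith [mul_le_mul_of_nonneg_left hLT (by linarith : 0 ≤ B)]
  have hp : (n : ℝ) * pER n lam ≤ 2 ∧ 0 ≤ (n : ℝ) * pER n lam := by
    have h1 : |lam * (n : ℝ) ^ (-(1 / 3 : ℝ))| ≤ 2 * |lam| * ε := by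
      rw [abs_mul, abs_of_nonneg (Real.rpow_nonneg (by linarith) _)]
      linarith [mul_le_mul_of_nonneg_left hnε habs]
    obtain ⟨h2, h3⟩ := abs_le.1 h1
    rw [mul_pER hn]
    constructor <;> linarith
  have hn8 : (8 : ℝ) ≤ n := by
    have h1 : ε ≤ 1 / 20 := hεδ.trans hδ'
    have h2 : 20 ≤ √(T : ℝ) := by linarith [mul_le_mul_of_nonneg_right h1 hsqrt.le]
    have h3 : (400 : ℝ) ≤ T := by
      linarith [Real.mul_self_sqrt hTpos.le, mul_le_mul h2 h2 (by norm_num) hsqrt.le]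
    linarith [mul_le_mul_of_nonneg_left h1 (by linarith : (0 : ℝ) ≤ n)]
  have hp0 : 0 ≤ pER n lam := nonneg_of_mul_nonneg_right hp.2 (by linarith)
  have hp4 : pER n lam ≤ 1 / 4 := by
    linarith [hp.1, mul_le_mul_of_nonneg_right hn8 hp0]
  have hp1 : pER n lam ≤ 1 := by linarith
  have hsn : s < n := by
    have : (s : ℝ) < n := by
      linarith [mul_le_mul_of_nonneg_left hBε (by linarith : (0 : ℝ) ≤ n)]
    exact_mod_cast this
  have hdrift := abs_drift_le (lam := lam) (B := B) (R := R) hn hT1 hε hnε hTε hs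
    (by linarith) hRε
  rw [← hC] at hdrift
  have hlow : ∀ E : Finset (Fin n), E.card ≤ s →
      c * ε ≤ (erMeasure n (pER n lam)).real {ω | erAlive ω (T - 1) (∅, E)} := by
    intro E hE
    refine hsurv n T (s + T) (pER n lam) ε hT1 hε hεδ hp0 hp4 hdrift E ?_ (by omega)
    rintro rfl
    rw [Finset.card_univ, Fintype.card_fin] at hE
    omega
  rw [← hLdef] at hLi hiL
  obtain ⟨j, rfl⟩ : ∃ j, i = j + 2 := ⟨i - 2, by omega⟩
  rw [← hTdef, ← hLdef, show j + 2 - 1 = j + 1 from rfl]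
  have := isProbabilityMeasure_erMeasure n hp0 hp1
  have hD := measurableSet_sigmaAt_le (monotone_erF n) (measurableSet_erHit_le n (j + 1)) s
  have key := ae_le_condExp_indicator (μ := erMeasure n (pER n lam))
    (E := {ω' | T ≤ erHit ω' (j + 2) - erHit ω' (j + 1)}) (c := c * ε)
    (MeasurableSpace.generateFrom_le fun _ _ => MeasurableSet.of_discrete)
    MeasurableSet.of_discrete hD fun S hSD hS => by
      have := mul_real_le_real_inter_excursion hp0 hp1 hS (fun ω hω => hSD hω) hlow
      rwa [Nat.sub_add_cancel hT1] at this
  filter_upwards [key] with ω hω hle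
  rw [hε, mul_one_div] at hω
  refine hω ?_
  rw [hsdef]
  exact Nat.le_floor hle

end
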